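/- arXiv:1809.08769 — 2 statements merged into one kernel-verified Lean document; each statement's English description precedes it below -/
import Mathlib

section
/- Let R be a commutative ring, A ∈ R^{n×n}, and let d_j denote the coefficient of X^j in det(I_n + X·A). The following are equivalent: (1) D_{k+1}(A) = 0 and d_k is a unit of R; (2) the range and the kernel of the linear map x ↦ A·x on R^n are complementary submodules, D_k(A) = R, and D_{k+1}(A) = 0. When these conditions hold, the matrix π := d_{k−1}·A − d_{k−2}·A² + ⋯ + (−1)^{k−1}·A^k satisfies π·A = d_k·A and π² = d_k·π, and d_k⁻¹·π is the idempotent matrix giving the projection of R^n onto the range of A along the kernel of A. -/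
open Matrix Polynomial

/-- The `k`-th determinantal ideal of a matrix. -/
noncomputable def detIdeal {R : Type*} [CommRing R] {m n : ℕ} (k : ℕ)
    (A : Matrix (Fin m) (Fin n) R) : Ideal R :=
  Ideal.span {x | ∃ (α : Fin k → Fin m) (β : Fin k → Fin n),
    StrictMono α ∧ StrictMono β ∧ x = (A.submatrix α β).det}

/-- `dCoeff A j` is the coefficient of `X^j` in `det(I + X·A)`. -/
noncomputable def dCoeff {R : Type*} [CommRing R] {n : ℕ}
    (A : Matrix (Fin n) (Fin n) R) (j : ℕ) : R :=
  (((1 : Matrix (Fin n) (Fin n) R[X]) + (X : R[X]) • A.map C).det).coeff j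

/-- `π = d_{k−1}·A − d_{k−2}·A² + ⋯ + (−1)^{k−1}·A^k`. -/
noncomputable def piMat {R : Type*} [CommRing R] {n : ℕ} (k : ℕ)
    (A : Matrix (Fin n) (Fin n) R) : Matrix (Fin n) (Fin n) R :=
  ∑ i ∈ Finset.range k, ((-1 : R) ^ i * dCoeff A (k - 1 - i)) • A ^ (i + 1)

section Helpers

variable {R : Type*} [CommRing R]

lemma det_submatrix_mem_detIdeal {p q k : ℕ} (A : Matrix (Fin p) (Fin q) R)
    (α : Fin k → Fin p) (β : Fin k → Fin q) : (A.submatrix α β).det ∈ detIdeal k A := by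
  by_cases hα : Function.Injective α
  · by_cases hβ : Function.Injective β
    · have h1 : StrictMono (α ∘ Tuple.sort α) :=
        (Tuple.monotone_sort α).strictMono_of_injective (hα.comp (Equiv.injective _))
      have h2 : StrictMono (β ∘ Tuple.sort β) :=
        (Tuple.monotone_sort β).strictMono_of_injective (hβ.comp (Equiv.injective _))
      have h3 : (A.submatrix (α ∘ Tuple.sort α) (β ∘ Tuple.sort β)).det ∈ detIdeal k A :=
        Ideal.subset_span ⟨_, _, h1, h2, rfl⟩
      have h4 : A.submatrix α β =
          ((A.submatrix (α ∘ Tuple.sort α) (β ∘ Tuple.sort β)).submatrix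
            (Tuple.sort α).symm id).submatrix id (Tuple.sort β).symm := by
        ext i j; simp
      rw [h4, Matrix.det_permute', Matrix.det_permute]
      exact Ideal.mul_mem_left _ _ (Ideal.mul_mem_left _ _ h3)
    · simp only [Function.Injective, not_forall] at hβ
      obtain ⟨a, b, hab, hne⟩ := hβ
      rw [Matrix.det_zero_of_column_eq hne (fun i => by simp [hab])]
      exact zero_mem _
  · simp only [Function.Injective, not_forall] at hα
    obtain ⟨a, b, hab, hne⟩ := hα
    rw [Matrix.det_zero_of_row_eq hne (by ext i; simp [hab])]
    exact zero_mem _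

lemma mixed_det_mem {p q j : ℕ} (A : Matrix (Fin p) (Fin q) R) (m : ℕ) :
    ∀ (M : Matrix (Fin m) (Fin m) R) (S : Finset (Fin m)) (α : Fin m → Fin p)
      (β : Fin m → Fin q), S.card = j → (∀ r ∈ S, ∀ c, M r c = A (α r) (β c)) →
      M.det ∈ detIdeal j A := by
  have full : ∀ (m : ℕ) (M : Matrix (Fin m) (Fin m) R) (S : Finset (Fin m)) (α : Fin m → Fin p)
      (β : Fin m → Fin q), S.card = j → (∀ r ∈ S, ∀ c, M r c = A (α r) (β c)) →
      S = Finset.univ → M.det ∈ detIdeal j A := by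
    intro m M S α β hS h hu
    subst hu
    have : m = j := by simpa using hS
    subst this
    have : M = A.submatrix α β := by ext r c; simp [h]
    rw [this]
    exact det_submatrix_mem_detIdeal A α β
  induction m with
  | zero =>
    intro M S α β hS h
    exact full 0 M S α β hS h (Subsingleton.elim _ _)
  | succ m ih =>
    intro M S α β hS h
    by_cases hu : S = Finset.univ
    · exact full _ M S α β hS h hu
    · obtain ⟨r, hr⟩ : ∃ r, r ∉ S := by
        by_contra hc
        push Not at hc
        exact hu (Finset.eq_univ_iff_forall.2 hc)
      rw [Matrix.det_succ_row M r]
      refine Ideal.sum_mem _ fun c _ => Ideal.mul_mem_left _ _ ?_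
      refine ih _ (Finset.univ.filter fun i => r.succAbove i ∈ S) (α ∘ r.succAbove)
        (β ∘ c.succAbove) ?_ ?_
      · rw [← hS, ← Finset.card_map r.succAboveEmb]
        congr 1
        ext i
        simp only [Finset.mem_map, Finset.mem_filter, Finset.mem_univ, true_and]
        constructor
        · rintro ⟨a, ha, rfl⟩; exact ha
        · intro hi
          obtain ⟨a, rfl⟩ := Fin.exists_succAbove_eq (x := i) (y := r) (by rintro rfl; exact hr hi)
          exact ⟨a, hi, rfl⟩
      · intro i hi c'
        simp only [Finset.mem_filter, Finset.mem_univ, true_and] at hi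
        simp [h _ hi]

lemma coeff_det_mem {n j : ℕ} (A B : Matrix (Fin n) (Fin n) R) :
    ((X : R[X]) • A.map C + B.map C).det.coeff j ∈ detIdeal j A := by
  let P : Finset (Fin n) → Matrix (Fin n) (Fin n) R := fun s =>
    Matrix.of fun r c => if r ∈ s then A r c else B r c
  have key : ((X : R[X]) • A.map C + B.map C).det =
      ∑ s : Finset (Fin n), X ^ s.card * C (P s).det := by
    have h := MultilinearMap.map_add_univ
      (Matrix.detRowAlternating (n := Fin n) (R := R[X])).toMultilinearMap
      (fun r c => X * C (A r c)) (fun r c => C (B r c))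
    refine Eq.trans ?_ (h.trans (Finset.sum_congr rfl fun s _ => ?_))
    · rfl
    have h2 := MultilinearMap.map_piecewise_smul
      (Matrix.detRowAlternating (n := Fin n) (R := R[X])).toMultilinearMap
      (fun _ => X) (fun r c => C (P s r c)) s
    rw [Finset.prod_const] at h2
    have h3 : C (P s).det = (Matrix.detRowAlternating (n := Fin n) (R := R[X])).toMultilinearMap
        (fun r c => C (P s r c)) := RingHom.map_det C (P s)
    rw [h3, ← smul_eq_mul, ← h2]
    congr 1
    funext r c
    by_cases hr : r ∈ s
    · simp [Finset.piecewise, hr, P]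
    · simp [Finset.piecewise, hr, P]
  rw [key, Polynomial.finsetSum_coeff]
  refine Ideal.sum_mem _ fun s _ => ?_
  rw [mul_comm, Polynomial.coeff_C_mul_X_pow]
  split_ifs with hs
  · refine mixed_det_mem A n _ s id id hs.symm ?_
    intro r hr c
    simp [P, hr]
  · exact zero_mem _

lemma dCoeff_mem {n : ℕ} (A : Matrix (Fin n) (Fin n) R) (j : ℕ) :
    dCoeff A j ∈ detIdeal j A := by
  have := coeff_det_mem (j := j) A 1
  rw [Matrix.map_one _ (map_zero _) (map_one _), add_comm] at this
  exact this

lemma adj_coeff_mem {n : ℕ} (A : Matrix (Fin n) (Fin n) R) (j : ℕ) (a b : Fin n) :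
    (((1 : Matrix (Fin n) (Fin n) R[X]) + (X : R[X]) • A.map C).adjugate a b).coeff j
      ∈ detIdeal j A := by
  have h := coeff_det_mem (j := j) (A.updateRow b 0)
    ((1 : Matrix (Fin n) (Fin n) R).updateRow b (Pi.single a 1))
  have hle : detIdeal j (A.updateRow b 0) ≤ detIdeal j A := by
    refine Ideal.span_le.2 ?_
    rintro x ⟨α, β, hα, hβ, rfl⟩
    by_cases hb : ∃ i, α i = b
    · obtain ⟨i, hi⟩ := hb
      rw [Matrix.det_eq_zero_of_row_eq_zero i (fun c => by simp [hi])]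
      exact zero_mem _
    · push Not at hb
      have : (A.updateRow b 0).submatrix α β = A.submatrix α β := by
        ext i c; simp [Matrix.updateRow_ne (hb i)]
      rw [this]
      exact Ideal.subset_span ⟨α, β, hα, hβ, rfl⟩
  have e : ((X : R[X]) • (A.updateRow b 0).map C +
      ((1 : Matrix (Fin n) (Fin n) R).updateRow b (Pi.single a 1)).map C) =
      ((1 : Matrix (Fin n) (Fin n) R[X]) + (X : R[X]) • A.map C).updateRow b (Pi.single a 1) := by
    ext1 i c
    by_cases hi : i = b
    · subst hi
      simp [Pi.single_apply, apply_ite (C : R →+* R[X])]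
    · simp [Matrix.updateRow_ne hi, Matrix.one_apply, apply_ite (C : R →+* R[X]), add_comm]
  rw [Matrix.adjugate_apply, ← e]
  exact hle h

lemma piMat_succ {n : ℕ} (A : Matrix (Fin n) (Fin n) R) (k : ℕ) :
    piMat (k + 1) A = dCoeff A k • A - piMat k A * A := by
  unfold piMat
  rw [Finset.sum_range_succ', Finset.sum_mul, sub_eq_add_neg, add_comm, ← Finset.sum_neg_distrib]
  congr 1
  · simp
  · refine Finset.sum_congr rfl fun i hi => ?_
    have : k + 1 - 1 - (i + 1) = k - 1 - i := by omega
    rw [this, pow_succ (-1 : R), pow_succ A (i + 1), Matrix.smul_mul, ← neg_smul]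
    congr 1
    ring

lemma adj_coeff_eq {n : ℕ} (A : Matrix (Fin n) (Fin n) R) (k : ℕ) :
    ((1 : Matrix (Fin n) (Fin n) R[X]) + (X : R[X]) • A.map C).adjugate.map (fun p => p.coeff k)
      = dCoeff A k • 1 - piMat k A := by
  set M := (1 : Matrix (Fin n) (Fin n) R[X]) + (X : R[X]) • A.map C with hM
  have h : M.adjugate + (X : R[X]) • (M.adjugate * A.map C) = M.det • 1 := by
    rw [← Matrix.adjugate_mul M]
    conv_rhs => rw [hM, mul_add, mul_one, Matrix.mul_smul, ← hM]
  induction k with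
  | zero =>
    ext i j
    have h1 := congrArg (fun p => p.coeff 0) (congrFun (congrFun h i) j)
    simp only [Matrix.add_apply, Matrix.smul_apply, smul_eq_mul, coeff_add, mul_coeff_zero,
      coeff_X_zero, zero_mul, add_zero] at h1
    simp only [Matrix.map_apply, h1, piMat, Finset.range_zero, Finset.sum_empty, sub_zero,
      Matrix.smul_apply, smul_eq_mul, dCoeff, ← hM]
    congr 1
    simp [Matrix.one_apply, apply_ite (fun p : R[X] => p.coeff 0)]
  | succ k ih =>
    rw [piMat_succ]
    have h2 : M.adjugate.map (fun p => p.coeff (k + 1)) +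
        M.adjugate.map (fun p => p.coeff k) * A = dCoeff A (k + 1) • 1 := by
      ext i j
      have h1 := congrArg (fun p => p.coeff (k + 1)) (congrFun (congrFun h i) j)
      simp only [Matrix.add_apply, Matrix.smul_apply, smul_eq_mul, coeff_add, coeff_X_mul,
        Matrix.mul_apply, finsetSum_coeff, Matrix.map_apply, coeff_mul_C] at h1
      simp only [Matrix.add_apply, Matrix.map_apply, Matrix.mul_apply, h1,
        Matrix.smul_apply, smul_eq_mul, dCoeff, ← hM]
      by_cases hij : i = j
      · subst hij
        simp
      · simp [hij]
    rw [ih] at h2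
    rw [eq_sub_of_add_eq h2, sub_mul, Matrix.smul_mul, one_mul]

lemma piMat_mul {n k : ℕ} (A : Matrix (Fin n) (Fin n) R) (h : detIdeal (k + 1) A = ⊥) :
    piMat k A * A = dCoeff A k • A := by
  have h1 : dCoeff A (k + 1) = 0 := by
    have := dCoeff_mem A (k + 1); rwa [h, Ideal.mem_bot] at this
  have h2 := adj_coeff_eq A (k + 1)
  have h3 : ((1 : Matrix (Fin n) (Fin n) R[X]) + (X : R[X]) • A.map C).adjugate.map
      (fun p => p.coeff (k + 1)) = 0 := by
    ext a b
    have := adj_coeff_mem A (k + 1) a b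
    rw [h, Ideal.mem_bot] at this
    simpa using this
  rw [h3, h1, zero_smul, zero_sub, piMat_succ] at h2
  have h4 := neg_eq_zero.1 h2.symm
  exact (sub_eq_zero.1 h4).symm

lemma piMat_factor {n : ℕ} (k : ℕ) (A : Matrix (Fin n) (Fin n) R) :
    ∃ Q : Matrix (Fin n) (Fin n) R, piMat k A = A * Q ∧ piMat k A = Q * A := by
  refine ⟨∑ i ∈ Finset.range k, ((-1 : R) ^ i * dCoeff A (k - 1 - i)) • A ^ i, ?_, ?_⟩
  · simp [piMat, Finset.mul_sum, pow_succ']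
  · simp [piMat, Finset.sum_mul, pow_succ]

lemma proj_facts {n k : ℕ} (A : Matrix (Fin n) (Fin n) R) (h : detIdeal (k + 1) A = ⊥)
    (hu : IsUnit (dCoeff A k)) :
      (piMat k A * A = dCoeff A k • A ∧
       piMat k A * piMat k A = dCoeff A k • piMat k A ∧
       ∃ u : R, u * dCoeff A k = 1 ∧
         ((u • piMat k A) * (u • piMat k A) = u • piMat k A ∧
          LinearMap.range (u • piMat k A).mulVecLin = LinearMap.range A.mulVecLin ∧
          LinearMap.ker (u • piMat k A).mulVecLin = LinearMap.ker A.mulVecLin)) := by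
  obtain ⟨Q, hQ1, hQ2⟩ := piMat_factor k A
  have h1 := piMat_mul A h
  have h1' : A * piMat k A = dCoeff A k • A := by
    rw [← h1]
    nth_rewrite 1 [hQ2]
    rw [hQ1, mul_assoc]
  have h2 : piMat k A * piMat k A = dCoeff A k • piMat k A := by
    nth_rewrite 2 [hQ1]
    rw [← mul_assoc, h1, Matrix.smul_mul, ← hQ1]
  obtain ⟨u, hu'⟩ := hu.exists_left_inv
  have eA : (u • piMat k A) * A = A := by rw [Matrix.smul_mul, h1, smul_smul, hu', one_smul]
  have Ae : A * (u • piMat k A) = A := by rw [Matrix.mul_smul, h1', smul_smul, hu', one_smul]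
  refine ⟨h1, h2, u, hu', ?_, ?_, ?_⟩
  · rw [Matrix.smul_mul, Matrix.mul_smul, h2, smul_smul u (dCoeff A k), hu', one_smul]
  · apply le_antisymm
    · rw [hQ1, ← Matrix.mul_smul, Matrix.mulVecLin_mul]
      exact LinearMap.range_comp_le_range _ _
    · conv_lhs => rw [← eA, Matrix.mulVecLin_mul]
      exact LinearMap.range_comp_le_range _ _
  · apply le_antisymm
    · conv_rhs => rw [← Ae, Matrix.mulVecLin_mul]
      exact LinearMap.ker_le_ker_comp _ _
    · rw [hQ2, ← Matrix.smul_mul, Matrix.mulVecLin_mul]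
      exact LinearMap.ker_le_ker_comp _ _

lemma isUnit_of_minor {n k : ℕ} (A B : Matrix (Fin n) (Fin n) R) (h : detIdeal (k + 1) A = ⊥)
    (hB : A = A * A * B) (α β : Fin k → Fin n) (hm : IsUnit (A.submatrix α β).det) :
    IsUnit (dCoeff A k) := by
  set W := A.submatrix α β with hW
  let _ : Invertible W := Matrix.invertibleOfIsUnitDet W hm
  set U := A.submatrix id β with hU
  set V := ⅟W * A.submatrix α id with hV
  have hA : A = U * V := by
    ext i j
    have hd : (fromBlocks W (A.submatrix α (fun _ : Fin 1 => j))
        (A.submatrix (fun _ : Fin 1 => i) β)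
        (A.submatrix (fun _ : Fin 1 => i) (fun _ : Fin 1 => j))).det = 0 := by
      have hmem := det_submatrix_mem_detIdeal A
        ((Sum.elim α (fun _ : Fin 1 => i)) ∘ finSumFinEquiv.symm : Fin (k + 1) → Fin n)
        ((Sum.elim β (fun _ : Fin 1 => j)) ∘ finSumFinEquiv.symm : Fin (k + 1) → Fin n)
      rw [h, Ideal.mem_bot, ← Matrix.submatrix_submatrix, Matrix.det_submatrix_equiv_self] at hmem
      rw [← hmem]
      congr 1
      ext a b
      rcases a with a | a <;> rcases b with b | b <;> rfl
    rw [Matrix.det_fromBlocks₁₁] at hd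
    have hd2 := (hm.mul_right_eq_zero).1 hd
    rw [Matrix.det_fin_one, Matrix.sub_apply, sub_eq_zero] at hd2
    rw [hV, ← Matrix.mul_assoc]
    exact hd2
  have hVβ : V.submatrix id β = 1 := by
    have : V.submatrix id β = ⅟W * W := by
      ext a b; simp [hV, hW, Matrix.mul_apply]
    rw [this, invOf_mul_self]
  have hUα : U.submatrix α id = W := rfl
  have e1 : U * (V * U * (V * B)) = U * V := by
    conv_rhs => rw [← hA, hB, hA]
    simp only [Matrix.mul_assoc]
  have e2 : W * (V * U * (V * B)) = W * V := by
    ext a b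
    have := congrFun (congrFun e1 (α a)) b
    simp only [Matrix.mul_apply] at this ⊢
    exact this
  have e3 : V * U * (V * B) = V := by
    have := congrArg (fun M => ⅟W * M) e2
    simpa only [← Matrix.mul_assoc, invOf_mul_self, Matrix.one_mul] using this
  have e4 : V * U * (V * B).submatrix id β = 1 := by
    rw [← hVβ]
    conv_rhs => rw [← e3]
    rfl
  have hdet : dCoeff A k = (V * U).det := by
    unfold dCoeff
    have := coeff_det_X_add_C_card (V * U) 1
    rw [Fintype.card_fin, Matrix.map_one _ (map_zero _) (map_one _)] at this
    rw [← this]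
    congr 1
    conv_lhs => rw [hA]
    rw [Matrix.map_mul, ← Matrix.smul_mul, Matrix.det_one_add_mul_comm, Matrix.mul_smul,
      ← Matrix.map_mul, add_comm]
  rw [hdet]
  have := congrArg Matrix.det e4
  rw [Matrix.det_mul, Matrix.det_one] at this
  exact IsUnit.of_mul_eq_one _ this

lemma dCoeff_map {S : Type*} [CommRing S] (f : R →+* S) {n : ℕ} (A : Matrix (Fin n) (Fin n) R)
    (k : ℕ) : dCoeff (A.map f) k = f (dCoeff A k) := by
  unfold dCoeff
  rw [← Polynomial.coeff_map, ← Polynomial.coe_mapRingHom, RingHom.map_det]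
  congr 2
  ext1 i j
  by_cases hij : i = j
  · simp [hij]
  · simp [hij]

lemma isUnit_of_isCompl {n k : ℕ} (A : Matrix (Fin n) (Fin n) R)
    (hc : IsCompl (LinearMap.range A.mulVecLin) (LinearMap.ker A.mulVecLin))
    (hk : detIdeal k A = ⊤) (h : detIdeal (k + 1) A = ⊥) : IsUnit (dCoeff A k) := by
  obtain ⟨B, hB⟩ : ∃ B, A = A * A * B := by
    have hx : ∀ j : Fin n, ∃ y : Fin n → R, A *ᵥ (Pi.single j 1) = A *ᵥ (A *ᵥ y) := by
      intro j
      have : (Pi.single j 1 : Fin n → R) ∈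
          LinearMap.range A.mulVecLin ⊔ LinearMap.ker A.mulVecLin := by
        rw [hc.sup_eq_top]; trivial
      obtain ⟨a, ⟨y, hy⟩, z, hz, hs⟩ := Submodule.mem_sup.1 this
      refine ⟨y, ?_⟩
      rw [← hs, Matrix.mulVec_add, ← hy]
      have hz' : A *ᵥ z = 0 := hz
      rw [hz', add_zero]
      rfl
    choose y hy using hx
    refine ⟨Matrix.of fun i j => y j i, ?_⟩
    ext i j
    have := congrFun (hy j) i
    rw [Matrix.mulVec_single_one, Matrix.mulVec_mulVec] at this
    exact this
  by_contra hn
  obtain ⟨m, hm, hmem⟩ := exists_max_ideal_of_mem_nonunits hn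
  obtain ⟨α, β, hαβ⟩ : ∃ (α β : Fin k → Fin n), (A.submatrix α β).det ∉ m := by
    by_contra hcon
    push Not at hcon
    apply hm.ne_top
    rw [eq_top_iff, ← hk]
    refine Ideal.span_le.2 ?_
    rintro x ⟨α, β, _, _, rfl⟩
    exact hcon α β
  let _ : Field (R ⧸ m) := Ideal.Quotient.field m
  let f := Ideal.Quotient.mk m
  have h' : detIdeal (k + 1) (A.map f) = ⊥ := by
    rw [eq_bot_iff]
    refine Ideal.span_le.2 ?_
    rintro x ⟨α, β, _, _, rfl⟩
    have h1 := det_submatrix_mem_detIdeal A α β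
    rw [h, Ideal.mem_bot] at h1
    have h2 : ((A.map f).submatrix α β).det = f (A.submatrix α β).det := by
      rw [RingHom.map_det]; rfl
    rw [h2, h1, map_zero]
    exact zero_mem _
  have hu := isUnit_of_minor (A.map f) (B.map f) h'
    (by rw [← Matrix.map_mul, ← Matrix.map_mul, ← hB]) α β (by
      have h2 : ((A.map f).submatrix α β).det = f (A.submatrix α β).det := by
        rw [RingHom.map_det]; rfl
      rw [h2, isUnit_iff_ne_zero]
      exact fun h0 => hαβ (Ideal.Quotient.eq_zero_iff_mem.1 h0))
  rw [dCoeff_map] at hu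
  exact hu.ne_zero (Ideal.Quotient.eq_zero_iff_mem.2 hmem)

end Helpers

theorem stmt14 {R : Type*} [CommRing R] {n k : ℕ} (A : Matrix (Fin n) (Fin n) R) :
    ((detIdeal (k + 1) A = ⊥ ∧ IsUnit (dCoeff A k)) ↔
      (IsCompl (LinearMap.range A.mulVecLin) (LinearMap.ker A.mulVecLin) ∧
        detIdeal k A = ⊤ ∧ detIdeal (k + 1) A = ⊥)) ∧
    (detIdeal (k + 1) A = ⊥ → IsUnit (dCoeff A k) →
      (piMat k A * A = dCoeff A k • A ∧
       piMat k A * piMat k A = dCoeff A k • piMat k A ∧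
       ∃ u : R, u * dCoeff A k = 1 ∧
         ((u • piMat k A) * (u • piMat k A) = u • piMat k A ∧
          LinearMap.range (u • piMat k A).mulVecLin = LinearMap.range A.mulVecLin ∧
          LinearMap.ker (u • piMat k A).mulVecLin = LinearMap.ker A.mulVecLin))) := by
  refine ⟨⟨?_, ?_⟩, fun h hu => proj_facts A h hu⟩
  · rintro ⟨h, hu⟩
    refine ⟨?_, Ideal.eq_top_of_isUnit_mem _ (dCoeff_mem A k) hu, h⟩
    obtain ⟨-, -, u, -, hid, hr, hk⟩ := proj_facts A h hu
    rw [← hr, ← hk]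
    apply LinearMap.IsIdempotentElem.isCompl
    unfold IsIdempotentElem
    rw [Module.End.mul_eq_comp, ← Matrix.mulVecLin_mul, hid]
  · rintro ⟨hc, hk, h⟩
    exact ⟨h, isUnit_of_isCompl A hc hk h⟩
end

section
/- Let R be a commutative ring, A ∈ R^{m×n}, A° ∈ R^{n×m}, and let a_j denote the coefficient of Z^j in det(I_m + Z·(A·A°)). The following are equivalent: (1) the pair (A, A°) is crossed and D_k(A) = R, D_{k+1}(A) = 0 (A is of rank k); (2) D_{k+1}(A) = 0, D_{k+1}(A°) = 0, and a_k is a unit of R. -/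
open Matrix Polynomial

/-- `aCoeff A A' j` is the coefficient of `Z^j` in `det(I_m + Z·(A·A'))`. -/
noncomputable def aCoeff {R : Type*} [CommRing R] {m n : ℕ}
    (A : Matrix (Fin m) (Fin n) R) (A' : Matrix (Fin n) (Fin m) R) (j : ℕ) : R :=
  (((1 : Matrix (Fin m) (Fin m) R[X]) + (X : R[X]) • (A * A').map C).det).coeff j

/-- The pair `(A, A')` is crossed. -/
def Crossed {R : Type*} [CommRing R] {m n : ℕ}
    (A : Matrix (Fin m) (Fin n) R) (A' : Matrix (Fin n) (Fin m) R) : Prop :=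
  IsCompl (LinearMap.range A.mulVecLin) (LinearMap.ker A'.mulVecLin) ∧
    IsCompl (LinearMap.ker A.mulVecLin) (LinearMap.range A'.mulVecLin)


section helpers
variable {R : Type*} [CommRing R]

theorem minor_mem {m n : ℕ} {j : ℕ} (A : Matrix (Fin m) (Fin n) R)
    (α : Fin j → Fin m) (β : Fin j → Fin n) : (A.submatrix α β).det ∈ detIdeal j A := by
  by_cases hα : Function.Injective α
  swap
  · rw [Function.not_injective_iff] at hα
    obtain ⟨a, b, hab, hne⟩ := hα
    rw [det_zero_of_row_eq hne (by ext; simp [hab])]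
    exact zero_mem _
  by_cases hβ : Function.Injective β
  swap
  · rw [Function.not_injective_iff] at hβ
    obtain ⟨a, b, hab, hne⟩ := hβ
    rw [det_zero_of_column_eq hne (by intro; simp [hab])]
    exact zero_mem _
  have h1 : StrictMono (α ∘ Tuple.sort α) :=
    (Tuple.monotone_sort α).strictMono_of_injective (hα.comp (Tuple.sort α).injective)
  have h2 : StrictMono (β ∘ Tuple.sort β) :=
    (Tuple.monotone_sort β).strictMono_of_injective (hβ.comp (Tuple.sort β).injective)
  have h3 : (A.submatrix (α ∘ Tuple.sort α) (β ∘ Tuple.sort β)).det ∈ detIdeal j A :=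
    Ideal.subset_span ⟨_, _, h1, h2, rfl⟩
  have h4 : A.submatrix (α ∘ Tuple.sort α) (β ∘ Tuple.sort β) =
      ((A.submatrix α β).submatrix (Tuple.sort α) id).submatrix id (Tuple.sort β) := rfl
  rw [h4, det_permute', det_permute] at h3
  have key : ∀ (u v : ℤˣ) (x : R), ((u : ℤ) : R) * (((v : ℤ) : R) * x) ∈ detIdeal j A →
      x ∈ detIdeal j A := by
    intro u v x hx
    have := Ideal.mul_mem_left _ (((u : ℤ) : R) * ((v : ℤ) : R)) hx
    rcases Int.units_eq_one_or u with rfl | rfl <;> rcases Int.units_eq_one_or v with rfl | rfl <;>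
      simpa using hx
  exact key _ _ _ h3

theorem minor_mem' {m n : ℕ} {ι : Type*} [Fintype ι] [DecidableEq ι] (A : Matrix (Fin m) (Fin n) R)
    (α : ι → Fin m) (β : ι → Fin n) : (A.submatrix α β).det ∈ detIdeal (Fintype.card ι) A := by
  have e := (Fintype.equivFin ι).symm
  rw [← det_submatrix_equiv_self e]
  exact minor_mem A (α ∘ e) (β ∘ e)

theorem minor_mul_mem {m n p : ℕ} {ι : Type*} [Fintype ι] [DecidableEq ι]
    (N : Matrix (Fin p) (Fin m) R) (A : Matrix (Fin m) (Fin n) R)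
    (α : ι → Fin p) (β : ι → Fin n) :
    ((N * A).submatrix α β).det ∈ detIdeal (Fintype.card ι) A := by
  have h : (N * A).submatrix α β = fun i => ∑ l, N (α i) l • (fun c => A l (β c)) := by
    ext i c
    simp [Matrix.mul_apply, Finset.sum_apply]
  have h2 : ((N * A).submatrix α β).det = (detRowAlternating (R := R) (n := ι)).toMultilinearMap
     (fun i => ∑ l, N (α i) l • (fun c => A l (β c))) := by rw [h]; rfl
  rw [h2, MultilinearMap.map_sum]
  refine Ideal.sum_mem _ fun r _ => ?_
  rw [MultilinearMap.map_smul_univ, smul_eq_mul]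
  exact Ideal.mul_mem_left _ _ (minor_mem' A r β)

theorem detIdeal_transpose {m n : ℕ} (k : ℕ) (A : Matrix (Fin m) (Fin n) R) :
    detIdeal k Aᵀ = detIdeal k A := by
  unfold detIdeal
  congr 1
  ext x
  constructor
  · rintro ⟨α, β, h1, h2, rfl⟩
    exact ⟨β, α, h2, h1, by rw [← det_transpose]; rfl⟩
  · rintro ⟨α, β, h1, h2, rfl⟩
    exact ⟨β, α, h2, h1, by rw [← det_transpose]; rfl⟩

theorem detIdeal_mul_le_right {m n p : ℕ} (k : ℕ)
    (N : Matrix (Fin p) (Fin m) R) (A : Matrix (Fin m) (Fin n) R) :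
    detIdeal k (N * A) ≤ detIdeal k A := by
  refine Ideal.span_le.2 ?_
  rintro _ ⟨α, β, -, -, rfl⟩
  simpa using minor_mul_mem N A α β

theorem detIdeal_mul_le_left {m n p : ℕ} (k : ℕ)
    (A : Matrix (Fin m) (Fin n) R) (N : Matrix (Fin n) (Fin p) R) :
    detIdeal k (A * N) ≤ detIdeal k A := by
  rw [← detIdeal_transpose k A, ← detIdeal_transpose, transpose_mul]
  exact detIdeal_mul_le_right _ _ _

/-- coefficients of `det (1 + X M)`. -/
noncomputable def eCoeff {ι : Type*} [Fintype ι] [DecidableEq ι] (M : Matrix ι ι R) (j : ℕ) : R :=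
  (((1 : Matrix ι ι R[X]) + (X : R[X]) • M.map C).det).coeff j

theorem eCoeff_mem {m : ℕ} (M : Matrix (Fin m) (Fin m) R) (j : ℕ) :
    eCoeff M j ∈ detIdeal j M := by
  unfold eCoeff
  rw [coeff_det_one_add_X_smul_eq_sum_minors]
  refine Ideal.sum_mem _ fun s hs => ?_
  have := minor_mem' M (Subtype.val : s → _) (Subtype.val : s → _)
  rwa [Fintype.card_coe, (Finset.mem_powersetCard.mp hs).2] at this

theorem eCoeff_smul {ι : Type*} [Fintype ι] [DecidableEq ι] (c : R) (M : Matrix ι ι R) (j : ℕ) :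
    eCoeff (c • M) j = c ^ j * eCoeff M j := by
  unfold eCoeff
  rw [coeff_det_one_add_X_smul_eq_sum_minors, coeff_det_one_add_X_smul_eq_sum_minors,
    Finset.mul_sum]
  refine Finset.sum_congr rfl fun s hs => ?_
  rw [submatrix_smul]
  simp only [Pi.smul_apply]
  rw [det_smul, Fintype.card_coe, (Finset.mem_powersetCard.mp hs).2]

theorem eCoeff_transpose {ι : Type*} [Fintype ι] [DecidableEq ι] (M : Matrix ι ι R) (j : ℕ) :
    eCoeff Mᵀ j = eCoeff M j := by
  unfold eCoeff
  rw [← det_transpose]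
  congr 2
  simp [transpose_map]

theorem eCoeff_mul_comm {ι κ : Type*} [Fintype ι] [DecidableEq ι] [Fintype κ] [DecidableEq κ]
    (F : Matrix ι κ R) (G : Matrix κ ι R) (j : ℕ) :
    eCoeff (F * G) j = eCoeff (G * F) j := by
  unfold eCoeff
  rw [Matrix.map_mul, Matrix.map_mul, ← Matrix.smul_mul, det_one_add_mul_comm, Matrix.mul_smul]

theorem charpoly_coeff_eCoeff {k : ℕ} (M : Matrix (Fin k) (Fin k) R) (j : ℕ) (hj : j ≤ k) :
    M.charpoly.coeff (k - j) = (-1) ^ j * eCoeff M j := by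
  have := charpoly_coeff_eq_sum_minors M j (by simpa using hj)
  rw [← coeff_det_one_add_X_smul_eq_sum_minors] at this
  simpa [eCoeff] using this

theorem eCoeff_self {k : ℕ} (M : Matrix (Fin k) (Fin k) R) : eCoeff M k = M.det := by
  have := charpoly_coeff_eCoeff M k le_rfl
  rw [det_eq_sign_charpoly_coeff, Fintype.card_fin]
  rw [Nat.sub_self] at this
  rw [this, ← mul_assoc, ← pow_add, Even.neg_one_pow ⟨k, rfl⟩, one_mul]

theorem det_bordered_aux {k : ℕ} (M : Matrix (Fin k) (Fin k) R) (u : Matrix (Fin k) Unit R)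
    (v : Matrix Unit (Fin k) R) (d : Matrix Unit Unit R) :
    M.det * (fromBlocks M u v d).det = M.det * (M.det • d - v * M.adjugate * u).det := by
  have h : fromBlocks M u v d * fromBlocks 1 (-(M.adjugate * u)) 0 (M.det • 1) =
      fromBlocks M 0 v (M.det • d - v * M.adjugate * u) := by
    rw [fromBlocks_multiply]
    congr 1
    · simp
    · rw [Matrix.mul_neg, ← Matrix.mul_assoc, mul_adjugate]; simp
    · simp
    · rw [Matrix.mul_neg, ← Matrix.mul_assoc]; simp [sub_eq_neg_add]
  have := congrArg det h
  rw [det_mul, det_fromBlocks_zero₂₁, det_fromBlocks_zero₁₂] at this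
  rw [← this]; simp [mul_comm]

theorem det_bordered {k : ℕ} (M : Matrix (Fin k) (Fin k) R) (u : Matrix (Fin k) Unit R)
    (v : Matrix Unit (Fin k) R) (d : Matrix Unit Unit R) :
    (fromBlocks M u v d).det = (M.det • d - v * M.adjugate * u).det := by
  have h := det_bordered_aux (charmatrix (-M)) (u.map C) (v.map C) (d.map C)
  have hr : IsLeftRegular (charmatrix (-M)).det := ((charpoly_monic (-M)).isRegular).left
  have h2 := hr h
  have h3 := congrArg (evalRingHom (0 : R)) h2
  have hM : (charmatrix (-M)).map (evalRingHom (0 : R)) = M := by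
    ext i j
    simp [charmatrix_apply, diagonal_apply]
    split_ifs <;> simp
  have hC : ∀ {a b : Type} (N : Matrix a b R), (N.map C).map (evalRingHom (0 : R)) = N := by
    intro a b N; ext; simp
  have hMd : evalRingHom (0 : R) (charmatrix (-M)).det = M.det := by
    rw [RingHom.map_det, RingHom.mapMatrix_apply, hM]
  have hMa : ((charmatrix (-M)).adjugate).map (evalRingHom (0 : R)) = M.adjugate := by
    rw [← RingHom.mapMatrix_apply, RingHom.map_adjugate, RingHom.mapMatrix_apply, hM]
  rw [RingHom.map_det, RingHom.map_det, RingHom.mapMatrix_apply, RingHom.mapMatrix_apply,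
    fromBlocks_map, hM, hC, hC, hC] at h3
  rw [h3]
  congr 1
  rw [Matrix.map_sub _ (map_sub _), Matrix.map_mul, Matrix.map_mul, hC, hC, hMa]
  congr 1
  ext i j
  rw [Matrix.map_apply, Matrix.smul_apply, smul_eq_mul, map_mul, hMd]
  simp

theorem factor {m n k : ℕ} (A : Matrix (Fin m) (Fin n) R) (hA : detIdeal (k + 1) A = ⊥)
    (α : Fin k → Fin m) (β : Fin k → Fin n) :
    (A.submatrix α β).det • A =
      A.submatrix id β * ((A.submatrix α β).adjugate * A.submatrix α id) := by
  ext i j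
  have h := minor_mem' A (Sum.elim α (fun _ : Unit => i)) (Sum.elim β (fun _ : Unit => j))
  rw [Fintype.card_sum, Fintype.card_fin, Fintype.card_unit, hA, Ideal.mem_bot] at h
  have h2 : A.submatrix (Sum.elim α (fun _ : Unit => i)) (Sum.elim β (fun _ : Unit => j)) =
    fromBlocks (A.submatrix α β) (A.submatrix α (fun _ => j)) (A.submatrix (fun _ => i) β)
      (A.submatrix (fun _ => i) (fun _ => j)) := by
    ext (a | a) (b | b) <;> rfl
  rw [h2, det_bordered, det_unique, Matrix.sub_apply, sub_eq_zero] at h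
  rw [← Matrix.mul_assoc]
  exact h

theorem span_trick {m n k : ℕ} (A : Matrix (Fin m) (Fin n) R) (hA : detIdeal k A = ⊤)
    (J : Ideal R) (h : ∀ (α : Fin k → Fin m) (β : Fin k → Fin n),
      ∃ N, (A.submatrix α β).det ^ N ∈ J) : J = ⊤ := by
  rw [← Ideal.radical_eq_top, eq_top_iff, ← hA]
  refine Ideal.span_le.2 ?_
  rintro _ ⟨α, β, -, -, rfl⟩
  exact h α β

/-- the generalized Cayley-Hamilton polynomial. -/
noncomputable def Q {ι : Type*} [Fintype ι] [DecidableEq ι] (k : ℕ) (M : Matrix ι ι R) :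
    Matrix ι ι R :=
  ∑ i ∈ Finset.range (k + 1), ((-1) ^ i * eCoeff M (k - i)) • M ^ i

theorem Q_smul {ι : Type*} [Fintype ι] [DecidableEq ι] (k : ℕ) (c : R) (M : Matrix ι ι R) :
    Q k (c • M) = c ^ k • Q k M := by
  unfold Q
  rw [Finset.smul_sum]
  refine Finset.sum_congr rfl fun i hi => ?_
  have hik : i ≤ k := by have := Finset.mem_range.1 hi; omega
  have hp : c ^ k = c ^ (k - i) * c ^ i := by rw [← pow_add, Nat.sub_add_cancel hik]
  rw [eCoeff_smul, _root_.smul_pow, smul_smul, smul_smul, hp]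
  congr 1
  ring

theorem Q_self {k : ℕ} (M : Matrix (Fin k) (Fin k) R) : Q k M = 0 := by
  nontriviality R
  have h := aeval_self_charpoly M
  rw [aeval_eq_sum_range, charpoly_natDegree_eq_dim, Fintype.card_fin] at h
  have : Q k M = (-1 : R) ^ k • ∑ i ∈ Finset.range (k + 1), M.charpoly.coeff i • M ^ i := by
    unfold Q
    rw [Finset.smul_sum]
    refine Finset.sum_congr rfl fun i hi => ?_
    have hi := Finset.mem_range.1 hi
    have := charpoly_coeff_eCoeff M (k - i) (by omega)
    rw [show k - (k - i) = i by omega] at this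
    rw [this, smul_smul, ← mul_assoc, ← pow_add]
    congr 2
    rw [show k + (k - i) = i + 2 * (k - i) by omega, pow_add, pow_mul]
    simp
  rw [this, h, smul_zero]

theorem Q_mul {ι κ : Type*} [Fintype ι] [DecidableEq ι] [Fintype κ] [DecidableEq κ]
    (k : ℕ) (F : Matrix ι κ R) (G : Matrix κ ι R) : Q k (F * G) * F = F * Q k (G * F) := by
  unfold Q
  rw [Matrix.sum_mul, Matrix.mul_sum]
  refine Finset.sum_congr rfl fun i hi => ?_
  rw [eCoeff_mul_comm, Matrix.smul_mul, Matrix.mul_smul]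
  congr 1
  clear hi
  induction i with
  | zero => simp
  | succ i ih => rw [pow_succ', pow_succ', Matrix.mul_assoc, ih]; simp only [Matrix.mul_assoc]

theorem Q_transpose {ι : Type*} [Fintype ι] [DecidableEq ι]
    (k : ℕ) (M : Matrix ι ι R) : Q k Mᵀ = (Q k M)ᵀ := by
  unfold Q
  rw [transpose_sum]
  refine Finset.sum_congr rfl fun i hi => ?_
  rw [eCoeff_transpose, transpose_smul, transpose_pow]

theorem Q_mul_eq_zero {m n k : ℕ} (A : Matrix (Fin m) (Fin n) R) (A' : Matrix (Fin n) (Fin m) R)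
    (h1 : detIdeal k A = ⊤) (h2 : detIdeal (k + 1) A = ⊥) : Q k (A * A') * A = 0 := by
  ext i j
  have hJ : (R ∙ ((Q k (A * A') * A) i j)).annihilator = ⊤ := by
    refine span_trick A h1 _ fun α β => ⟨k + 1, ?_⟩
    rw [Submodule.mem_annihilator_span_singleton]
    have hf := factor A h2 α β
    set μ := (A.submatrix α β).det
    set F := A.submatrix id β
    set G := (A.submatrix α β).adjugate * A.submatrix α id
    have : μ ^ (k + 1) • (Q k (A * A') * A) = 0 := by
      calc μ ^ (k + 1) • (Q k (A * A') * A) = Q k (μ • (A * A')) * (μ • A) := by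
            rw [Q_smul, Matrix.smul_mul, Matrix.mul_smul, smul_smul, pow_succ]
        _ = Q k (F * (G * A')) * F * G := by
            rw [← Matrix.smul_mul, hf]; simp only [Matrix.mul_assoc]
        _ = 0 := by rw [Q_mul, Q_self]; simp
    simpa using congrFun (congrFun this i) j
  have : (1 : R) ∈ (R ∙ ((Q k (A * A') * A) i j)).annihilator := by rw [hJ]; trivial
  rw [Submodule.mem_annihilator_span_singleton, one_smul] at this
  simpa using this

theorem eCoeff_isUnit {m n k : ℕ} (A : Matrix (Fin m) (Fin n) R) (A' : Matrix (Fin n) (Fin m) R)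
    (h1 : detIdeal k A = ⊤) (h2 : detIdeal (k + 1) A = ⊥)
    (Z : Matrix (Fin n) (Fin n) R) (hZ : A = A * A' * A * Z) : IsUnit (eCoeff (A * A') k) := by
  rw [← Ideal.span_singleton_eq_top]
  refine span_trick A h1 _ fun α β => ⟨2 * k + 1, ?_⟩
  rw [Ideal.mem_span_singleton]
  have hf := factor A h2 α β
  set μ := (A.submatrix α β).det with hμ
  set F := A.submatrix id β
  set G := (A.submatrix α β).adjugate * A.submatrix α id
  have e1 : (G * A' * F).det = μ ^ k * eCoeff (A * A') k := by
    rw [← eCoeff_smul, ← Matrix.smul_mul, hf, ← eCoeff_self, Matrix.mul_assoc, eCoeff_mul_comm]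
    simp only [Matrix.mul_assoc]
    rw [eCoeff_mul_comm, ← Matrix.mul_assoc, ← Matrix.mul_assoc, ← Matrix.mul_assoc]
  have e2 : μ ^ 2 • A = F * (G * A' * F) * (G * Z) := by
    calc μ ^ 2 • A = (μ • A) * A' * (μ • A) * Z := by
          conv_lhs => rw [hZ]
          simp only [Matrix.smul_mul, Matrix.mul_smul, smul_smul, pow_two]
      _ = _ := by rw [hf]; simp only [Matrix.mul_assoc]
  have e3 : μ ^ 2 • A.submatrix α β =
      F.submatrix α id * (G * A' * F) * (G * Z).submatrix id β := by
    have := congrArg (fun M => M.submatrix α β) e2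
    exact this
  have e4 := congrArg det e3
  rw [det_smul, det_mul, det_mul, e1, Fintype.card_fin, ← hμ, ← pow_mul, ← pow_succ] at e4
  rw [e4]
  exact ⟨(F.submatrix α id).det * μ ^ k * ((G * Z).submatrix id β).det, by ring⟩

end helpers

theorem stmt15 {R : Type*} [CommRing R] {m n k : ℕ}
    (A : Matrix (Fin m) (Fin n) R) (A' : Matrix (Fin n) (Fin m) R) :
    (Crossed A A' ∧ detIdeal k A = ⊤ ∧ detIdeal (k + 1) A = ⊥) ↔
      (detIdeal (k + 1) A = ⊥ ∧ detIdeal (k + 1) A' = ⊥ ∧ IsUnit (aCoeff A A' k)) := by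
  change _ ↔ (detIdeal (k + 1) A = ⊥ ∧ detIdeal (k + 1) A' = ⊥ ∧ IsUnit (eCoeff (A * A') k))
  constructor
  · rintro ⟨⟨hc1, hc2⟩, h1, h2⟩
    have hQ : ∃ Q : Matrix (Fin n) (Fin m) R, A' = A' * A * Q := by
      have : ∀ i : Fin m, ∃ q : Fin n → R, A'.col i = A' *ᵥ (A *ᵥ q) := by
        intro i
        have hi : (Pi.single i 1 : Fin m → R) ∈
            LinearMap.range A.mulVecLin ⊔ LinearMap.ker A'.mulVecLin := by
          rw [hc1.sup_eq_top]; trivial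
        obtain ⟨y, ⟨q, rfl⟩, z, hz, hyz⟩ := Submodule.mem_sup.1 hi
        refine ⟨q, ?_⟩
        have hz : A' *ᵥ z = 0 := hz
        have := congrArg (fun v => A' *ᵥ v) hyz
        simp only [mulVec_add, hz, add_zero, mulVec_single_one, mulVecLin_apply] at this
        exact this.symm
      choose q hq using this
      refine ⟨Matrix.of fun a b => q b a, ?_⟩
      ext a b
      have := congrFun (hq b) a
      rw [mulVec_mulVec] at this
      exact this
    have hP : ∃ P : Matrix (Fin m) (Fin n) R, A = A * A' * P := by
      have : ∀ i : Fin n, ∃ q : Fin m → R, A.col i = A *ᵥ (A' *ᵥ q) := by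
        intro i
        have hi : (Pi.single i 1 : Fin n → R) ∈
            LinearMap.range A'.mulVecLin ⊔ LinearMap.ker A.mulVecLin := by
          rw [sup_comm, hc2.sup_eq_top]; trivial
        obtain ⟨y, ⟨q, rfl⟩, z, hz, hyz⟩ := Submodule.mem_sup.1 hi
        refine ⟨q, ?_⟩
        have hz : A *ᵥ z = 0 := hz
        have := congrArg (fun v => A *ᵥ v) hyz
        simp only [mulVec_add, hz, add_zero, mulVec_single_one, mulVecLin_apply] at this
        exact this.symm
      choose q hq using this
      refine ⟨Matrix.of fun a b => q b a, ?_⟩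
      ext a b
      have := congrFun (hq b) a
      rw [mulVec_mulVec] at this
      exact this
    obtain ⟨Q, hQ⟩ := hQ
    obtain ⟨P, hP⟩ := hP
    refine ⟨h2, ?_, ?_⟩
    · rw [eq_bot_iff, ← h2, hQ, Matrix.mul_assoc]
      exact (detIdeal_mul_le_right _ _ _).trans (detIdeal_mul_le_left _ _ _)
    · refine eCoeff_isUnit A A' h1 h2 (Q * P) ?_
      conv_lhs => rw [hP, hQ]
      simp only [Matrix.mul_assoc]
  · rintro ⟨h2, h2', hu⟩
    have hm := eCoeff_mem (A * A') k
    have h1 : detIdeal k A = ⊤ :=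
      Ideal.eq_top_of_isUnit_mem _ (detIdeal_mul_le_left k A A' hm) hu
    have h1' : detIdeal k A' = ⊤ :=
      Ideal.eq_top_of_isUnit_mem _ (detIdeal_mul_le_right k A A' hm) hu
    have hA : Q k (A * A') * A = 0 := Q_mul_eq_zero A A' h1 h2
    have hA' : A' * Q k (A * A') = 0 := by
      have := Q_mul_eq_zero A'ᵀ Aᵀ (by rw [detIdeal_transpose, h1'])
        (by rw [detIdeal_transpose, h2'])
      rw [← transpose_mul, Q_transpose, ← transpose_mul] at this
      exact transpose_eq_zero.1 this
    set B := A * A' with hB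
    obtain ⟨D, hcomm, hD⟩ : ∃ D, D * B = B * D ∧ Q k B = eCoeff B k • 1 - B * D := by
      refine ⟨-∑ i ∈ Finset.range k, ((-1) ^ (i + 1) * eCoeff B (k - (i + 1))) • B ^ i, ?_, ?_⟩
      · rw [Matrix.neg_mul, Matrix.mul_neg, Matrix.sum_mul, Matrix.mul_sum]
        congr 1
        refine Finset.sum_congr rfl fun i _ => ?_
        rw [Matrix.smul_mul, Matrix.mul_smul, ← pow_succ, ← pow_succ']
      · unfold Q
        rw [Finset.sum_range_succ', Matrix.mul_neg, sub_neg_eq_add, add_comm, Matrix.mul_sum]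
        congr 1
        · simp
        · refine Finset.sum_congr rfl fun i _ => ?_
          rw [Matrix.mul_smul, ← pow_succ']
    obtain ⟨u, hu⟩ := hu
    rw [hD, ← hu] at hA hA'
    rw [Matrix.sub_mul, sub_eq_zero, Matrix.smul_mul, Matrix.one_mul] at hA
    rw [Matrix.mul_sub, sub_eq_zero, Matrix.mul_smul, Matrix.mul_one] at hA'
    obtain ⟨E, hE⟩ : ∃ E, E = (↑u⁻¹ : R) • D := ⟨_, rfl⟩
    have hA2 : A = B * E * A := by
      rw [hE, Matrix.mul_smul, Matrix.smul_mul, ← hA, smul_smul]; simp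
    have hA2' : A' = A' * (B * E) := by
      rw [hE, Matrix.mul_smul, Matrix.mul_smul, ← hA', smul_smul]; simp
    have hc : E * B = B * E := by rw [hE, Matrix.smul_mul, Matrix.mul_smul, hcomm]
    refine ⟨⟨⟨?_, ?_⟩, ⟨?_, ?_⟩⟩, h1, h2⟩
    · rw [Submodule.disjoint_def]
      rintro _ ⟨y, rfl⟩ hx
      have hx : A' *ᵥ (A *ᵥ y) = 0 := hx
      change A *ᵥ y = 0
      rw [hA2, ← hc, hB, ← mulVec_mulVec, ← mulVec_mulVec, ← mulVec_mulVec, hx]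
      simp
    · rw [codisjoint_iff, eq_top_iff]
      intro y _
      refine Submodule.mem_sup.2 ⟨A *ᵥ (A' *ᵥ (E *ᵥ y)), ⟨_, rfl⟩, y - A *ᵥ (A' *ᵥ (E *ᵥ y)), ?_, ?_⟩
      · change A' *ᵥ _ = 0
        rw [mulVec_sub, sub_eq_zero]
        conv_lhs => rw [hA2', hB]
        simp only [mulVec_mulVec, Matrix.mul_assoc]
      · simp
    · rw [Submodule.disjoint_def]
      rintro _ hx ⟨y, rfl⟩
      have hx : A *ᵥ (A' *ᵥ y) = 0 := hx
      change A' *ᵥ y = 0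
      rw [hA2', ← hc, hB, ← mulVec_mulVec, ← mulVec_mulVec, ← mulVec_mulVec, hx]
      simp
    · rw [codisjoint_iff, eq_top_iff]
      intro y _
      refine Submodule.mem_sup.2 ⟨y - A' *ᵥ (E *ᵥ (A *ᵥ y)), ?_, A' *ᵥ (E *ᵥ (A *ᵥ y)), ⟨_, rfl⟩, ?_⟩
      · change A *ᵥ _ = 0
        rw [mulVec_sub, sub_eq_zero]
        conv_lhs => rw [hA2, hB]
        simp only [mulVec_mulVec, Matrix.mul_assoc]
      · simp
end
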